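/- Fix γ > −1. (1) The backprojection I₀^♯μ^{−2γ−1} maps μ^{2γ+1}C^∞_{α,+,+}(∂₊S𝔻) into C^∞(𝔻). (2) For every ψ ∈ μ^{2γ+1}C^∞_{α,+,+}(∂₊S𝔻): I₀^♯(μ^{−2γ−1} 𝓣_γ ψ) = 𝓛_γ ( I₀^♯(μ^{−2γ−1}ψ) ) and I₀^♯(μ^{−2γ−1} ∂_β ψ) = ∂_ω ( I₀^♯(μ^{−2γ−1}ψ) ) on 𝔻. -/

import Mathlib

open MeasureTheory Complex Metric Real Set

noncomputable section

/-! ## Geometry of the Euclidean disk and its space of lines (fan-beam coordinates) -/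

/-- The chord of the closed unit disk through the boundary point `exp (I β)` with incoming
direction `exp (I (β + π + α))`, parametrized by arclength `t ∈ [0, 2 cos α]`. -/
def chord (β α t : ℝ) : ℂ :=
  Complex.exp ((β : ℂ) * Complex.I) +
    (t : ℂ) * Complex.exp (((β + π + α : ℝ) : ℂ) * Complex.I)

/-- The X-ray transform `I₀` in fan-beam coordinates. -/
def XRT (f : ℂ → ℂ) (β α : ℝ) : ℂ :=
  ∫ t in (0:ℝ)..(2 * Real.cos α), f (chord β α t)

/-- The fan-beam coordinate `α₋(z, θ)` of the unique chord through `z` with direction `exp (I θ)`,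
determined by `sin α₋ = Im (z * exp (-I θ))`. -/
def alpham (z : ℂ) (θ : ℝ) : ℝ :=
  Real.arcsin ((z * Complex.exp (-(θ : ℂ) * Complex.I)).im)

/-- The fan-beam coordinate `β₋(z, θ)`, determined by `β₋ + α₋ + π = θ`. -/
def betam (z : ℂ) (θ : ℝ) : ℝ := θ - π - alpham z θ

/-- Reduction modulo `2π` to the fundamental interval `(0, 2π]`. -/
def wrap (x : ℝ) : ℝ := toIocMod Real.two_pi_pos 0 x

/-- The backprojection operator `I₀^♯`. -/
def BP (g : ℝ × ℝ → ℂ) (z : ℂ) : ℂ :=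
  ∫ θ in (0:ℝ)..(2 * π), g (wrap (betam z θ), alpham z θ)

/-- The weighted backprojection operator `I₀^♯ μ^{-2γ-1}`, where `μ(β, α) = cos α`. -/
def BPW (γ : ℝ) (g : ℝ × ℝ → ℂ) : ℂ → ℂ :=
  BP fun p => ((Real.cos p.2 ^ (-(2 * γ) - 1) : ℝ) : ℂ) * g p

/-- The rectangle `(0, 2π] × [-π/2, π/2]` modelling the space of lines `∂₊S𝔻`. -/
def Rect : Set (ℝ × ℝ) := Set.Ioc (0:ℝ) (2 * π) ×ˢ Set.Icc (-(π / 2)) (π / 2)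

/-- The measure `μ^{-2γ} dβ dα` on `∂₊S𝔻`, where `μ(β, α) = cos α`. -/
def bdryMeasure (γ : ℝ) : Measure (ℝ × ℝ) :=
  ((volume : Measure (ℝ × ℝ)).restrict Rect).withDensity
    fun p => ENNReal.ofReal (Real.cos p.2 ^ (-(2 * γ)))

/-- The measure `d^γ dz` on the closed unit disk, where `d(z) = 1 - |z|²`. -/
def diskMeasure (γ : ℝ) : Measure ℂ :=
  ((volume : Measure ℂ).restrict (Metric.closedBall 0 1)).withDensity
    fun z => ENNReal.ofReal ((1 - ‖z‖ ^ 2) ^ γ)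

/-- `L n` is the monic orthogonal polynomial of degree `n` on `[-1, 1]` for the weight
`(1 - x²)^(γ + 1/2)`. -/
def IsMonicOrtho (γ : ℝ) (L : ℕ → Polynomial ℝ) : Prop :=
  ∀ n, (L n).Monic ∧ (L n).natDegree = n ∧
    ∀ m, m < n →
      (∫ x in (-1:ℝ)..(1:ℝ), (L n).eval x * x ^ m * (1 - x ^ 2) ^ (γ + 1/2)) = 0

/-- The functions `ψ_{n,k}^γ = μ^{2γ+1} ((-1)^n / 2π) e^{i(n-2k)(β+α)} L_n^γ (sin α)`. -/
def psiF (γ : ℝ) (L : ℕ → Polynomial ℝ) (n : ℕ) (k : ℤ) (p : ℝ × ℝ) : ℂ :=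
  ((Real.cos p.2 ^ (2 * γ + 1) : ℝ) : ℂ) * (((-1 : ℝ) ^ n / (2 * π) : ℝ) : ℂ) *
    Complex.exp (Complex.I * ((n : ℂ) - 2 * (k : ℂ)) * ((p.1 + p.2 : ℝ) : ℂ)) *
    (((L n).eval (Real.sin p.2) : ℝ) : ℂ)

/-- The generalized Zernike polynomials
`G_{n,k}^γ (z) = (1/2π) ∫₀^{2π} e^{i(n-2k)θ} L_n^γ ((i/2)(z̄ e^{iθ} - z e^{-iθ})) dθ`. -/
def GZ (γ : ℝ) (L : ℕ → Polynomial ℝ) (n : ℕ) (k : ℤ) (z : ℂ) : ℂ :=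
  ((1 / (2 * π) : ℝ) : ℂ) * ∫ θ in (0:ℝ)..(2 * π),
    Complex.exp (Complex.I * ((n : ℂ) - 2 * (k : ℂ)) * (θ : ℂ)) *
      Polynomial.aeval
        ((Complex.I / 2) *
          ((starRingEnd ℂ) z * Complex.exp ((θ : ℂ) * Complex.I) -
            z * Complex.exp (-(θ : ℂ) * Complex.I))) (L n)

/-- `L²(𝔻, d^γ dz)`-norm. -/
def dNorm (γ : ℝ) (f : ℂ → ℂ) : ℝ := Real.sqrt (∫ z, ‖f z‖ ^ 2 ∂(diskMeasure γ))

/-- `L²(∂₊S𝔻, μ^{-2γ} dβ dα)`-norm. -/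
def bNorm (γ : ℝ) (g : ℝ × ℝ → ℂ) : ℝ := Real.sqrt (∫ p, ‖g p‖ ^ 2 ∂(bdryMeasure γ))

/-- `G_{n,k}^γ` normalized to unit norm in `L²(𝔻, d^γ dz)`. -/
def Ghat (γ : ℝ) (L : ℕ → Polynomial ℝ) (n : ℕ) (k : ℤ) (z : ℂ) : ℂ :=
  (((dNorm γ (GZ γ L n k))⁻¹ : ℝ) : ℂ) * GZ γ L n k z

/-- `ψ_{n,k}^γ` normalized to unit norm in `L²(∂₊S𝔻, μ^{-2γ} dβ dα)`. -/
def psihat (γ : ℝ) (L : ℕ → Polynomial ℝ) (n : ℕ) (k : ℤ) (p : ℝ × ℝ) : ℂ :=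
  (((bNorm γ (psiF γ L n k))⁻¹ : ℝ) : ℂ) * psiF γ L n k p

/-- The squared singular values `(σ_{n,k}^γ)²`. -/
def sigSq (γ : ℝ) (n k : ℕ) : ℝ :=
  2 ^ (2 * γ + 2) * π * (n.choose k) *
    Real.Gamma ((n : ℝ) - k + γ + 1) * Real.Gamma ((k : ℝ) + γ + 1) /
      Real.Gamma ((n : ℝ) + 2 * γ + 2)

/-- The singular values `σ_{n,k}^γ ≥ 0`. -/
def sig (γ : ℝ) (n k : ℕ) : ℝ := Real.sqrt (sigSq γ n k)

/-- The Beta function `B(x,y) = Γ(x)Γ(y)/Γ(x+y)`. -/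
def betaFn (x y : ℝ) : ℝ := Real.Gamma x * Real.Gamma y / Real.Gamma (x + y)

/-! ## Differential operators -/

/-- Radial derivative `∂_ρ` in polar coordinates `z = ρ e^{iω}`. -/
def dRho (f : ℂ → ℂ) (z : ℂ) : ℂ :=
  deriv (fun r : ℝ => f ((r : ℂ) * Complex.exp ((z.arg : ℂ) * Complex.I))) ‖z‖

/-- Angular derivative `∂_ω` in polar coordinates `z = ρ e^{iω}`. -/
def dOmega (f : ℂ → ℂ) (z : ℂ) : ℂ :=
  deriv (fun w : ℝ => f ((‖z‖ : ℂ) * Complex.exp ((w : ℂ) * Complex.I))) z.arg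

/-- The operator `𝓛_γ = -(1-ρ²)∂_ρ² - (ρ⁻¹ - (3+2γ)ρ)∂_ρ - ρ⁻²∂_ω² + (γ+1)²`. -/
def Lop (γ : ℝ) (f : ℂ → ℂ) (z : ℂ) : ℂ :=
  -(1 - (‖z‖ : ℂ) ^ 2) * dRho (dRho f) z -
    ((‖z‖ : ℂ)⁻¹ - (3 + 2 * (γ : ℂ)) * (‖z‖ : ℂ)) * dRho f z -
    ((‖z‖ : ℂ) ^ 2)⁻¹ * dOmega (dOmega f) z + ((γ : ℂ) + 1) ^ 2 * f z

/-- `∂_β` on `∂₊S𝔻`. -/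
def dBeta (g : ℝ × ℝ → ℂ) (p : ℝ × ℝ) : ℂ := deriv (fun b : ℝ => g (b, p.2)) p.1

/-- `∂_α` on `∂₊S𝔻`. -/
def dAlpha (g : ℝ × ℝ → ℂ) (p : ℝ × ℝ) : ℂ := deriv (fun a : ℝ => g (p.1, a)) p.2

/-- The operator `T = ∂_β - ∂_α`. -/
def Tline (g : ℝ × ℝ → ℂ) (p : ℝ × ℝ) : ℂ := dBeta g p - dAlpha g p

/-- The power `μ^e = (cos α)^e` as a complex-valued function on `∂₊S𝔻`. -/
def muC (e : ℝ) (p : ℝ × ℝ) : ℂ := ((Real.cos p.2 ^ e : ℝ) : ℂ)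

/-- The operator `𝓣_γ = -μ^{2γ} T μ^{-2γ} T + γ²`. -/
def Tgam (γ : ℝ) (g : ℝ × ℝ → ℂ) (p : ℝ × ℝ) : ℂ :=
  -muC (2 * γ) p * Tline (fun q => muC (-(2 * γ)) q * Tline g q) p + (γ : ℂ) ^ 2 * g p

/-! ## Scattering relations and the space `C^∞_{α,+,+}(∂₊S𝔻)` -/

/-- The scattering relation `𝒮(β, α) = (β + π + 2α, π - α)`. -/
def Scat (p : ℝ × ℝ) : ℝ × ℝ := (p.1 + π + 2 * p.2, π - p.2)

/-- The antipodal scattering relation `𝒮_A(β, α) = (β + π + 2α, -α)`. -/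
def ScatA (p : ℝ × ℝ) : ℝ × ℝ := (p.1 + π + 2 * p.2, -p.2)

/-- Membership in `C^∞_{α,+,+}(∂₊S𝔻)`: `f`, given on the strip `ℝ × [-π/2, π/2]` (2π-periodically
in β), has an even extension through the scattering relation which is smooth on all of `∂S𝔻`
(modelled as a doubly 2π-periodic smooth function on `ℝ²` invariant under `𝒮`), and `f` is
invariant under the antipodal scattering relation. -/
def MemCapp (f : ℝ × ℝ → ℂ) : Prop :=
  ∃ F : ℝ × ℝ → ℂ, ContDiff ℝ (⊤ : ℕ∞) F ∧
    (∀ p : ℝ × ℝ, F (p.1 + 2 * π, p.2) = F p) ∧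
    (∀ p : ℝ × ℝ, F (p.1, p.2 + 2 * π) = F p) ∧
    (∀ p : ℝ × ℝ, F (Scat p) = F p) ∧
    (∀ p : ℝ × ℝ, p.2 ∈ Set.Icc (-(π / 2)) (π / 2) → F (ScatA p) = F p) ∧
    (∀ p : ℝ × ℝ, p.2 ∈ Set.Icc (-(π / 2)) (π / 2) → f p = F p)

/-- `C^∞(𝔻)`: smooth up to the boundary of the closed unit disk. -/
def CinfDisk (f : ℂ → ℂ) : Prop := ContDiffOn ℝ (⊤ : ℕ∞) f (Metric.closedBall 0 1)

end

noncomputable section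

/-! ## Integrals depending on a parameter -/

/-- Differentiation under the integral sign when the integrand and its derivative are jointly
continuous. -/
theorem hasFDerivAt_intervalIntegral_of_continuous {E F : Type*} [NormedAddCommGroup E]
    [NormedSpace ℝ E] [ProperSpace E] [NormedAddCommGroup F] [NormedSpace ℝ F]
    {f : E → ℝ → F} {f' : E → ℝ → E →L[ℝ] F} {s : Set E} {x₀ : E} (a b : ℝ)
    (hs : s ∈ nhds x₀) (hf : Continuous (Function.uncurry f))
    (hf' : Continuous (Function.uncurry f'))
    (h : ∀ x ∈ s, ∀ t, HasFDerivAt (fun y => f y t) (f' x t) x) :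
    HasFDerivAt (fun x => ∫ t in a..b, f x t) (∫ t in a..b, f' x₀ t) x₀ := by
  obtain ⟨r, hr, hrs⟩ := Metric.nhds_basis_closedBall.mem_iff.1 hs
  obtain ⟨C, hC⟩ := (((isCompact_closedBall x₀ r).prod
    (isCompact_uIcc (a := a) (b := b))).image hf').isBounded.exists_norm_le
  have hslice : ∀ x, Continuous (f x) := fun x => hf.uncurry_left x
  have hslice' : ∀ x, Continuous (f' x) := fun x => hf'.uncurry_left x
  refine intervalIntegral.hasFDerivAt_integral_of_dominated_of_fderiv_le
    (bound := fun _ => C) (Metric.closedBall_mem_nhds x₀ hr)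
    (Filter.Eventually.of_forall fun x => (hslice x).aestronglyMeasurable)
    ((hslice x₀).intervalIntegrable _ _) (hslice' x₀).aestronglyMeasurable
    (Filter.Eventually.of_forall fun t ht x hx => hC _ ⟨(x, t), ⟨hx, uIoc_subset_uIcc ht⟩, rfl⟩)
    intervalIntegrable_const
    (Filter.Eventually.of_forall fun t _ x hx => h x (hrs hx) t)

/-- An integral over a compact interval of a smooth function is smooth in the parameter. -/
theorem contDiff_intervalIntegral {E F : Type} [NormedAddCommGroup E] [NormedSpace ℝ E]
    [ProperSpace E] [NormedAddCommGroup F] [NormedSpace ℝ F] {f : E × ℝ → F} (a b : ℝ)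
    (hf : ContDiff ℝ (⊤ : ℕ∞) f) :
    ContDiff ℝ (⊤ : ℕ∞) fun x => ∫ t in a..b, f (x, t) := by
  refine contDiff_infty.2 fun n => ?_
  induction n generalizing F with
  | zero =>
    exact contDiff_zero.2 (intervalIntegral.continuous_parametric_intervalIntegral_of_continuous'
      (f := fun x t => f (x, t)) hf.continuous a b)
  | succ n ih =>
    have hf' : ContDiff ℝ (⊤ : ℕ∞)
        fun p : E × ℝ => (fderiv ℝ f p).comp (ContinuousLinearMap.inl ℝ E ℝ) :=
      (hf.fderiv_right (by simp)).clm_comp contDiff_const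
    have key : ∀ x, HasFDerivAt (fun x => ∫ t in a..b, f (x, t))
        (∫ t in a..b, (fderiv ℝ f (x, t)).comp (ContinuousLinearMap.inl ℝ E ℝ)) x := fun x =>
      hasFDerivAt_intervalIntegral_of_continuous (f := fun x t => f (x, t))
        (f' := fun x t => (fderiv ℝ f (x, t)).comp (ContinuousLinearMap.inl ℝ E ℝ)) a b
        Filter.univ_mem hf.continuous hf'.continuous fun y _ t =>
          ((hf.differentiable (by simp)) (y, t)).hasFDerivAt.comp y (hasFDerivAt_prodMk_left y t)
    rw [Nat.cast_succ, contDiff_succ_iff_fderiv]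
    refine ⟨fun x => (key x).differentiableAt, by simp, ?_⟩
    rw [funext fun x => (key x).fderiv]
    exact ih hf'

/-! ## Division of smooth functions by the cosine -/
theorem hasDerivAt_dAlpha {H : ℝ × ℝ → ℂ} (hH : Differentiable ℝ H) (p : ℝ × ℝ) :
    HasDerivAt (fun a => H (p.1, a)) (dAlpha H p) p.2 :=
  DifferentiableAt.hasDerivAt ((hH (p.1, p.2)).comp p.2 (by fun_prop))

theorem dAlpha_eq_fderiv {H : ℝ × ℝ → ℂ} (hH : Differentiable ℝ H) (p : ℝ × ℝ) :
    dAlpha H p = fderiv ℝ H p (0, 1) :=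
  ((hH (p.1, p.2)).hasFDerivAt.comp_hasDerivAt p.2
    ((hasDerivAt_const p.2 p.1).prodMk (hasDerivAt_id p.2))).deriv

theorem dBeta_eq_fderiv {H : ℝ × ℝ → ℂ} (hH : Differentiable ℝ H) (p : ℝ × ℝ) :
    dBeta H p = fderiv ℝ H p (1, 0) :=
  ((hH (p.1, p.2)).hasFDerivAt.comp_hasDerivAt p.1
    ((hasDerivAt_id p.1).prodMk (hasDerivAt_const p.1 p.2))).deriv

theorem contDiff_dAlpha {H : ℝ × ℝ → ℂ} (hH : ContDiff ℝ (⊤ : ℕ∞) H) :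
    ContDiff ℝ (⊤ : ℕ∞) (dAlpha H) := by
  rw [funext (dAlpha_eq_fderiv (hH.differentiable (by simp)))]
  exact (hH.fderiv_right (by simp)).clm_apply contDiff_const

theorem contDiff_dBeta {H : ℝ × ℝ → ℂ} (hH : ContDiff ℝ (⊤ : ℕ∞) H) :
    ContDiff ℝ (⊤ : ℕ∞) (dBeta H) := by
  rw [funext (dBeta_eq_fderiv (hH.differentiable (by simp)))]
  exact (hH.fderiv_right (by simp)).clm_apply contDiff_const

/-- Hadamard's lemma in the second variable. -/
theorem exists_eq_sub_mul {H : ℝ × ℝ → ℂ} (hH : ContDiff ℝ (⊤ : ℕ∞) H) {c : ℝ}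
    (hc : ∀ x, H (x, c) = 0) :
    ∃ A : ℝ × ℝ → ℂ, ContDiff ℝ (⊤ : ℕ∞) A ∧ ∀ p, H p = ((p.2 - c : ℝ) : ℂ) * A p := by
  have hH' := contDiff_dAlpha hH
  refine ⟨fun p => ∫ t in (0 : ℝ)..1, dAlpha H (p.1, c + t * (p.2 - c)),
    contDiff_intervalIntegral (f := fun q : (ℝ × ℝ) × ℝ =>
      dAlpha H (q.1.1, c + q.2 * (q.1.2 - c))) 0 1 (hH'.comp (by fun_prop)), fun p => ?_⟩
  have hd : ∀ t : ℝ, HasDerivAt (fun t : ℝ => H (p.1, c + t * (p.2 - c)))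
      (((p.2 - c : ℝ) : ℂ) * dAlpha H (p.1, c + t * (p.2 - c))) t := fun t => by
    have h1 : HasDerivAt (fun t : ℝ => c + t * (p.2 - c)) (p.2 - c) t := by
      simpa using ((hasDerivAt_id t).mul_const (p.2 - c)).const_add c
    exact (hasDerivAt_dAlpha (hH.differentiable (by simp))
      (p.1, c + t * (p.2 - c))).scomp t h1
  rw [← intervalIntegral.integral_const_mul,
    intervalIntegral.integral_eq_sub_of_hasDerivAt (fun t _ => hd t)
      (Continuous.intervalIntegrable (continuous_const.mul (hH'.continuous.comp (by fun_prop)))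
        _ _)]
  simp [hc]

/-- The derivative of `G` with respect to `sin α`. -/
def sinDeriv (G : ℝ × ℝ → ℂ) (p : ℝ × ℝ) : ℂ :=
  if Real.cos p.2 = 0 then -(dAlpha (dAlpha G) p / (Real.sin p.2 : ℂ))
  else dAlpha G p / (Real.cos p.2 : ℂ)

/-- Smooth functions of `(φ, α)` which depend on `α` only through `sin α`. -/
structure IsSinEven (G : ℝ × ℝ → ℂ) : Prop where
  contDiff : ContDiff ℝ (⊤ : ℕ∞) G
  reflect : ∀ x a, G (x, π - a) = G (x, a)
  periodic : ∀ x a, G (x, a + 2 * π) = G (x, a)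

theorem IsSinEven.differentiable {G : ℝ × ℝ → ℂ} (hG : IsSinEven G) : Differentiable ℝ G :=
  hG.contDiff.differentiable (by simp)

theorem IsSinEven.mul_left {G : ℝ × ℝ → ℂ} (hG : IsSinEven G) {m : ℝ → ℂ}
    (hm : ContDiff ℝ (⊤ : ℕ∞) m) : IsSinEven fun p => m p.1 * G p where
  contDiff := (hm.comp contDiff_fst).mul hG.contDiff
  reflect x a := by simp only [hG.reflect]
  periodic x a := by simp only [hG.periodic]

theorem IsSinEven.dAlpha_reflect {G : ℝ × ℝ → ℂ} (hG : IsSinEven G) (x a : ℝ) :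
    dAlpha G (x, π - a) = -dAlpha G (x, a) := by
  have h := deriv_comp_const_sub (fun a => G (x, a)) π a
  simp only [hG.reflect] at h
  simp [dAlpha, h]

theorem IsSinEven.dAlpha_periodic {G : ℝ × ℝ → ℂ} (hG : IsSinEven G) (x a : ℝ) :
    dAlpha G (x, a + 2 * π) = dAlpha G (x, a) := by
  have h := deriv_comp_add_const (fun a => G (x, a)) (2 * π) a
  simp only [hG.periodic] at h
  simp [dAlpha, h]

theorem IsSinEven.dAlpha_eq_zero {G : ℝ × ℝ → ℂ} (hG : IsSinEven G) (x : ℝ) {c : ℝ}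
    (hc : Real.cos c = 0) : dAlpha G (x, c) = 0 := by
  obtain ⟨k, rfl⟩ := Real.cos_eq_zero_iff.1 hc
  have hper : Function.Periodic (fun a => dAlpha G (x, a)) (2 * π) := hG.dAlpha_periodic x
  have h1 := hG.dAlpha_reflect x ((2 * k + 1) * π / 2)
  have h2 := hper.int_mul k (π - (2 * k + 1) * π / 2)
  have h3 : π - (2 * k + 1) * π / 2 + k * (2 * π) = (2 * k + 1) * π / 2 := by ring
  simp only [h3] at h2
  rw [h1] at h2
  exact self_eq_neg.1 h2

theorem IsSinEven.dAlpha_eq_cos_mul {G : ℝ × ℝ → ℂ} (hG : IsSinEven G) (p : ℝ × ℝ) :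
    dAlpha G p = (Real.cos p.2 : ℂ) * sinDeriv G p := by
  by_cases hc : Real.cos p.2 = 0
  · rw [hc, hG.dAlpha_eq_zero p.1 hc]; simp
  · have : (Real.cos p.2 : ℂ) ≠ 0 := by exact_mod_cast hc
    rw [sinDeriv, if_neg hc, mul_div_cancel₀ _ this]

theorem IsSinEven.contDiff_sinDeriv {G : ℝ × ℝ → ℂ} (hG : IsSinEven G) :
    ContDiff ℝ (⊤ : ℕ∞) (sinDeriv G) := by
  have hH := contDiff_dAlpha hG.contDiff
  have hcos : ContDiff ℝ (⊤ : ℕ∞) fun p : ℝ × ℝ => (Real.cos p.2 : ℂ) :=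
    Complex.ofRealCLM.contDiff.comp (Real.contDiff_cos.comp contDiff_snd)
  refine contDiff_iff_contDiffAt.2 fun p => ?_
  by_cases hc : Real.cos p.2 = 0
  · obtain ⟨A, hA, hAH⟩ := exists_eq_sub_mul hH fun x => hG.dAlpha_eq_zero x hc
    obtain ⟨B, hB, hBcos⟩ := exists_eq_sub_mul (c := p.2) hcos fun x => by simp only [hc, Complex.ofReal_zero]
    have slice : ∀ {Q : ℝ × ℝ → ℂ}, ContDiff ℝ (⊤ : ℕ∞) Q → ∀ x,
        HasDerivAt (fun a : ℝ => ((a - p.2 : ℝ) : ℂ) * Q (x, a)) (Q (x, p.2)) p.2 := by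
      intro Q hQ x
      have h1 : HasDerivAt (fun a : ℝ => ((a - p.2 : ℝ) : ℂ)) 1 p.2 := by
        simpa using ((hasDerivAt_id p.2).sub_const p.2).ofReal_comp
      exact (h1.fun_mul (hasDerivAt_dAlpha (hQ.differentiable (by simp)) (x, p.2))).congr_deriv
        (by simp)
    have hAd : ∀ x, dAlpha (dAlpha G) (x, p.2) = A (x, p.2) := fun x => by
      have := slice hA x
      simp only [← hAH (x, _)] at this
      exact this.deriv
    have hBd : ∀ x, B (x, p.2) = -(Real.sin p.2 : ℂ) := fun x => by
      have := slice hB x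
      have h2 := (Real.hasDerivAt_cos p.2).ofReal_comp
      have h3 := this.congr_of_eventuallyEq
        (Filter.Eventually.of_forall fun a => hBcos (x, a))
      simpa using h3.unique h2
    have hsin : (Real.sin p.2 : ℂ) ≠ 0 := by
      have := Real.sin_sq_add_cos_sq p.2
      intro h0
      rw [hc, Complex.ofReal_eq_zero.1 h0] at this
      norm_num at this
    have hBp : B p ≠ 0 := by rw [hBd p.1]; exact neg_ne_zero.2 hsin
    refine (hA.contDiffAt.mul (hB.contDiffAt.fun_inv hBp)).congr_of_eventuallyEq ?_
    filter_upwards [hB.continuous.continuousAt.eventually_ne hBp] with q hq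
    by_cases hqp : q.2 = p.2
    · obtain ⟨x, a⟩ := q
      simp only at hqp
      subst hqp
      rw [sinDeriv, if_pos hc, hAd, hBd, ← div_eq_mul_inv, div_neg]
    · have hne : ((q.2 - p.2 : ℝ) : ℂ) ≠ 0 := by exact_mod_cast sub_ne_zero.2 hqp
      have hcq : (Real.cos q.2 : ℂ) ≠ 0 := by rw [hBcos]; exact mul_ne_zero hne hq
      rw [sinDeriv, if_neg (by exact_mod_cast hcq), hBcos, hAH, mul_div_mul_left _ _ hne, div_eq_mul_inv]
  · refine (hH.contDiffAt.mul (hcos.contDiffAt.fun_inv (by exact_mod_cast hc))).congr_of_eventuallyEq ?_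
    have : Continuous fun q : ℝ × ℝ => Real.cos q.2 := by fun_prop
    filter_upwards [this.continuousAt.eventually_ne hc] with q hq
    rw [sinDeriv, if_neg hq, div_eq_mul_inv]

theorem IsSinEven.isSinEven_sinDeriv {G : ℝ × ℝ → ℂ} (hG : IsSinEven G) : IsSinEven (sinDeriv G) where
  contDiff := hG.contDiff_sinDeriv
  reflect x a := by
    have h := deriv_comp_const_sub (fun a => dAlpha G (x, a)) π a
    simp only [hG.dAlpha_reflect, deriv.fun_neg, neg_inj] at h
    have h' : dAlpha (dAlpha G) (x, π - a) = dAlpha (dAlpha G) (x, a) := h.symm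
    simp [sinDeriv, hG.dAlpha_reflect, h', Real.cos_pi_sub, neg_div_neg_eq]
  periodic x a := by
    have h := deriv_comp_add_const (fun a => dAlpha G (x, a)) (2 * π) a
    simp only [hG.dAlpha_periodic] at h
    have h' : dAlpha (dAlpha G) (x, a + 2 * π) = dAlpha (dAlpha G) (x, a) := h.symm
    simp [sinDeriv, hG.dAlpha_periodic, h']

/-! ## Backprojection of functions of `(θ, sin α)` -/

/-- The backprojection in the coordinates `(θ, α)`, where `θ = β + α + π`. -/
def bpInt (G : ℝ × ℝ → ℂ) (z : ℂ) : ℂ := ∫ θ in (0:ℝ)..(2 * π), G (θ, alpham z θ)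

theorem alpham_eq (z : ℂ) (θ : ℝ) :
    alpham z θ = Real.arcsin (z.im * Real.cos θ - z.re * Real.sin θ) := by
  have : (z * Complex.exp (-(θ : ℂ) * Complex.I)).im = z.im * Real.cos θ - z.re * Real.sin θ := by
    rw [← Complex.ofReal_neg, Complex.mul_im, Complex.exp_ofReal_mul_I_im,
      Complex.exp_ofReal_mul_I_re, Real.sin_neg, Real.cos_neg]
    ring
  rw [alpham, this]

theorem continuous_alpham : Continuous fun q : ℂ × ℝ => alpham q.1 q.2 := by
  simp only [alpham_eq]
  exact Real.continuous_arcsin.comp (by fun_prop)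

theorem abs_im_mul_cos_sub_le (z : ℂ) (θ : ℝ) :
    |z.im * Real.cos θ - z.re * Real.sin θ| ≤ ‖z‖ := by
  have h := Complex.abs_im_le_norm (z * Complex.exp (((-θ : ℝ) : ℂ) * Complex.I))
  rw [norm_mul, Complex.norm_exp_ofReal_mul_I, mul_one, Complex.mul_im,
    Complex.exp_ofReal_mul_I_im, Complex.exp_ofReal_mul_I_re, Real.sin_neg, Real.cos_neg] at h
  convert h using 2
  ring

theorem abs_sin_coord_lt_one {z : ℂ} (hz : z ∈ Metric.ball (0 : ℂ) 1) (θ : ℝ) :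
    -1 < z.im * Real.cos θ - z.re * Real.sin θ ∧ z.im * Real.cos θ - z.re * Real.sin θ < 1 :=
  abs_lt.1 ((abs_im_mul_cos_sub_le z θ).trans_lt (mem_ball_zero_iff.1 hz))

theorem sin_alpham {z : ℂ} (hz : z ∈ Metric.closedBall (0 : ℂ) 1) (θ : ℝ) :
    Real.sin (alpham z θ) = z.im * Real.cos θ - z.re * Real.sin θ := by
  have h := abs_le.1 ((abs_im_mul_cos_sub_le z θ).trans (mem_closedBall_zero_iff.1 hz))
  rw [alpham_eq, Real.sin_arcsin h.1 h.2]

theorem cos_alpham_pos {z : ℂ} (hz : z ∈ Metric.ball (0 : ℂ) 1) (θ : ℝ) :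
    0 < Real.cos (alpham z θ) := by
  obtain ⟨h1, h2⟩ := abs_sin_coord_lt_one hz θ
  rw [alpham_eq]
  exact Real.cos_pos_of_mem_Ioo ⟨Real.neg_pi_div_two_lt_arcsin.2 h1, Real.arcsin_lt_pi_div_two.2 h2⟩

theorem continuous_comp_alpham {G : ℝ × ℝ → ℂ} (hG : Continuous G) :
    Continuous fun q : ℂ × ℝ => G (q.2, alpham q.1 q.2) :=
  hG.comp (continuous_snd.prodMk continuous_alpham)

theorem intervalIntegrable_comp_alpham {G : ℝ × ℝ → ℂ} (hG : Continuous G) (z : ℂ) (a b : ℝ) :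
    IntervalIntegrable (fun θ => G (θ, alpham z θ)) volume a b :=
  ((continuous_comp_alpham hG).comp (continuous_const.prodMk continuous_id)).intervalIntegrable a b

theorem continuous_bpInt {G : ℝ × ℝ → ℂ} (hG : Continuous G) : Continuous (bpInt G) :=
  intervalIntegral.continuous_parametric_intervalIntegral_of_continuous'
    (f := fun z θ => G (θ, alpham z θ)) (continuous_comp_alpham hG) _ _

theorem contDiff_ofReal_sin : ContDiff ℝ (⊤ : ℕ∞) fun θ : ℝ => -(Real.sin θ : ℂ) :=
  (Complex.ofRealCLM.contDiff.comp Real.contDiff_sin).neg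

theorem contDiff_ofReal_cos : ContDiff ℝ (⊤ : ℕ∞) fun θ : ℝ => (Real.cos θ : ℂ) :=
  Complex.ofRealCLM.contDiff.comp Real.contDiff_cos

/-- The derivative of `bpInt G`, see `IsSinEven.hasFDerivAt_bpInt`. -/
def bpDeriv (G : ℝ × ℝ → ℂ) (z : ℂ) : ℂ →L[ℝ] ℂ :=
  bpInt (fun p => -(Real.sin p.1 : ℂ) * sinDeriv G p) z • Complex.ofRealCLM.comp Complex.reCLM +
    bpInt (fun p => (Real.cos p.1 : ℂ) * sinDeriv G p) z • Complex.ofRealCLM.comp Complex.imCLM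

theorem IsSinEven.hasDerivAt_arcsin {G : ℝ × ℝ → ℂ} (hG : IsSinEven G) (x : ℝ) {s : ℝ}
    (h₁ : -1 < s) (h₂ : s < 1) :
    HasDerivAt (fun s => G (x, Real.arcsin s)) (sinDeriv G (x, Real.arcsin s)) s := by
  have h := (hasDerivAt_dAlpha hG.differentiable (x, Real.arcsin s)).scomp s
    (Real.hasDerivAt_arcsin h₁.ne' h₂.ne)
  refine h.congr_deriv ?_
  have hpos : 0 < √(1 - s ^ 2) := Real.sqrt_pos.2 (by nlinarith)
  have hne : (√(1 - s ^ 2) : ℂ) ≠ 0 := by exact_mod_cast hpos.ne'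
  rw [hG.dAlpha_eq_cos_mul, Real.cos_arcsin, Complex.real_smul]
  push_cast
  field_simp

theorem IsSinEven.hasFDerivAt_bpInt {G : ℝ × ℝ → ℂ} (hG : IsSinEven G) {z : ℂ}
    (hz : z ∈ Metric.ball (0 : ℂ) 1) : HasFDerivAt (bpInt G) (bpDeriv G z) z := by
  have hca := (hG.isSinEven_sinDeriv.mul_left contDiff_ofReal_sin).contDiff.continuous
  have hcb := (hG.isSinEven_sinDeriv.mul_left contDiff_ofReal_cos).contDiff.continuous
  let f' : ℂ → ℝ → ℂ →L[ℝ] ℂ := fun z θ =>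
    (-(Real.sin θ : ℂ) * sinDeriv G (θ, alpham z θ)) •
        Complex.ofRealCLM.comp Complex.reCLM +
      ((Real.cos θ : ℂ) * sinDeriv G (θ, alpham z θ)) •
        Complex.ofRealCLM.comp Complex.imCLM
  have hf' : Continuous (Function.uncurry f') :=
    ((continuous_comp_alpham hca).smul continuous_const).add
      ((continuous_comp_alpham hcb).smul continuous_const)
  have h : ∀ w ∈ Metric.ball (0 : ℂ) 1, ∀ θ,
      HasFDerivAt (fun y => G (θ, alpham y θ)) (f' w θ) w := fun w hw θ => by
    obtain ⟨h₁, h₂⟩ := abs_sin_coord_lt_one hw θ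
    have hs : HasFDerivAt (fun y : ℂ => y.im * Real.cos θ - y.re * Real.sin θ)
        (Real.cos θ • Complex.imCLM - Real.sin θ • Complex.reCLM) w :=
      (Complex.imCLM.hasFDerivAt.mul_const (Real.cos θ)).sub
        (Complex.reCLM.hasFDerivAt.mul_const (Real.sin θ))
    simp only [alpham_eq]
    refine ((hG.hasDerivAt_arcsin θ h₁ h₂).hasFDerivAt.comp w hs).congr_fderiv ?_
    ext v
    simp [f', alpham_eq]
    ring
  refine (hasFDerivAt_intervalIntegral_of_continuous (f := fun z θ => G (θ, alpham z θ)) 0 (2 * π)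
    (Metric.isOpen_ball.mem_nhds hz) (continuous_comp_alpham hG.contDiff.continuous) hf'
    h).congr_fderiv ?_
  refine ContinuousLinearMap.ext fun v => ?_
  rw [ContinuousLinearMap.intervalIntegral_apply
    ((hf'.uncurry_left z).intervalIntegrable 0 (2 * π)) v]
  have hia := (intervalIntegrable_comp_alpham hca z 0 (2 * π)).mul_const (v.re : ℂ)
  have hib := (intervalIntegrable_comp_alpham hcb z 0 (2 * π)).mul_const (v.im : ℂ)
  have key := intervalIntegral.integral_add hia hib
  rw [intervalIntegral.integral_mul_const, intervalIntegral.integral_mul_const] at key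
  exact key

theorem IsSinEven.continuous_bpDeriv {G : ℝ × ℝ → ℂ} (hG : IsSinEven G) :
    Continuous (bpDeriv G) :=
  ((continuous_bpInt (hG.isSinEven_sinDeriv.mul_left contDiff_ofReal_sin).contDiff.continuous).smul
    continuous_const).add
  ((continuous_bpInt (hG.isSinEven_sinDeriv.mul_left contDiff_ofReal_cos).contDiff.continuous).smul
    continuous_const)

theorem IsSinEven.hasFDerivWithinAt_bpInt {G : ℝ × ℝ → ℂ} (hG : IsSinEven G) (z : ℂ) :
    HasFDerivWithinAt (bpInt G) (bpDeriv G z) (Metric.closedBall 0 1) z := by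
  rw [← closure_ball (0 : ℂ) one_ne_zero]
  refine hasFDerivWithinAt_closure_of_tendsto_fderiv
    (fun w hw => (hG.hasFDerivAt_bpInt hw).differentiableAt.differentiableWithinAt)
    (convex_ball 0 1) Metric.isOpen_ball
    (fun w _ => (continuous_bpInt hG.contDiff.continuous).continuousWithinAt) ?_
  refine (hG.continuous_bpDeriv.continuousWithinAt (s := Metric.ball 0 1)).tendsto.congr' ?_
  filter_upwards [self_mem_nhdsWithin] with w hw
  exact (hG.hasFDerivAt_bpInt hw).fderiv.symm

theorem IsSinEven.contDiffOn_bpInt {G : ℝ × ℝ → ℂ} (hG : IsSinEven G) :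
    ContDiffOn ℝ (⊤ : ℕ∞) (bpInt G) (Metric.closedBall 0 1) := by
  refine contDiffOn_infty.2 fun n => ?_
  induction n generalizing G with
  | zero => exact contDiffOn_zero.2 (continuous_bpInt hG.contDiff.continuous).continuousOn
  | succ n ih =>
    have hu : UniqueDiffOn ℝ (Metric.closedBall (0 : ℂ) 1) :=
      uniqueDiffOn_convex (convex_closedBall 0 1)
        ⟨0, Metric.ball_subset_interior_closedBall (Metric.mem_ball_self one_pos)⟩
    rw [Nat.cast_succ, contDiffOn_succ_iff_hasFDerivWithinAt_of_uniqueDiffOn hu]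
    refine ⟨by simp, bpDeriv G, ?_, fun z _ => hG.hasFDerivWithinAt_bpInt z⟩
    exact ((ih (hG.isSinEven_sinDeriv.mul_left contDiff_ofReal_sin)).smul contDiffOn_const).add
      ((ih (hG.isSinEven_sinDeriv.mul_left contDiff_ofReal_cos)).smul contDiffOn_const)

/-! ## The weighted backprojection in the coordinates `(θ, α)` -/

/-- A function in `C^∞_{α,+,+}` is a smooth function of `θ = β + α + π` and `sin α`. -/
theorem MemCapp.exists_isSinEven {h : ℝ × ℝ → ℂ} (hh : MemCapp h) :
    ∃ G : ℝ × ℝ → ℂ, IsSinEven G ∧ (∀ x a, G (x + 2 * π, a) = G (x, a)) ∧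
      ∀ b, ∀ a ∈ Set.Icc (-(π / 2)) (π / 2), h (b, a) = G (b + π + a, a) := by
  obtain ⟨F, hF, hper₁, hper₂, hS, -, hhF⟩ := hh
  refine ⟨fun p => F (p.1 - π - p.2, p.2), ⟨hF.comp (by fun_prop), fun x a => ?_, fun x a => ?_⟩,
    fun x a => ?_, fun b a ha => ?_⟩
  · have h1 := hS (x - π - a, a)
    have h2 := hper₁ (x - π - (π - a), π - a)
    simp only [Scat] at h1 h2 ⊢
    rw [← h1, ← h2]
    congr 2
    ring
  · have h1 := hper₁ (x - π - (a + 2 * π), a + 2 * π)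
    have h2 := hper₂ (x - π - a, a)
    simp only at h1 h2 ⊢
    rw [← h1, ← h2]
    congr 2
    ring
  · have h1 := hper₁ (x - π - a, a)
    simp only at h1 ⊢
    rw [← h1]
    congr 2
    ring
  · rw [hhF (b, a) ha]
    congr 2
    ring

theorem countable_cos_alpham_eq_zero {z : ℂ} (hz : z ∈ Metric.closedBall (0 : ℂ) 1) :
    {θ : ℝ | Real.cos (alpham z θ) = 0}.Countable := by
  refine (Set.countable_range fun k : ℤ => z.arg - (2 * k + 1) * π / 2).mono fun θ hθ => ?_
  have h1 := Real.sin_sq_add_cos_sq (alpham z θ)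
  rw [show Real.cos (alpham z θ) = 0 from hθ, sin_alpham hz, ← Complex.norm_mul_sin_arg z,
    ← Complex.norm_mul_cos_arg z] at h1
  have hz1 : ‖z‖ ≤ 1 := mem_closedBall_zero_iff.1 hz
  have h2 : ‖z‖ ^ 2 ≤ 1 := pow_le_one₀ (norm_nonneg z) hz1
  have h3 : (‖z‖ * Real.sin (z.arg - θ)) ^ 2 = 1 := by
    rw [Real.sin_sub]; linear_combination h1
  have h4 := Real.sin_sq_add_cos_sq (z.arg - θ)
  have h5 : Real.cos (z.arg - θ) = 0 := by
    have : Real.cos (z.arg - θ) ^ 2 ≤ 0 := by nlinarith [sq_nonneg (Real.sin (z.arg - θ))]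
    exact pow_eq_zero_iff two_ne_zero |>.1 (le_antisymm this (sq_nonneg _))
  obtain ⟨k, hk⟩ := Real.cos_eq_zero_iff.1 h5
  exact ⟨k, by simp only; linarith⟩

theorem BPW_eq_bpInt {γ : ℝ} {g G : ℝ × ℝ → ℂ} (hper : ∀ x a, G (x + 2 * π, a) = G (x, a))
    (hg : ∀ b, ∀ a ∈ Set.Ioo (-(π / 2)) (π / 2),
      g (b, a) = muC (2 * γ + 1) (b, a) * G (b + π + a, a))
    {z : ℂ} (hz : z ∈ Metric.closedBall (0 : ℂ) 1) : BPW γ g z = bpInt G z := by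
  refine intervalIntegral.integral_congr_ae ?_
  filter_upwards [(countable_cos_alpham_eq_zero hz).ae_notMem volume] with θ hθ _
  have hα : alpham z θ ∈ Set.Icc (-(π / 2)) (π / 2) := Real.arcsin_mem_Icc _
  have hα' : alpham z θ ∈ Set.Ioo (-(π / 2)) (π / 2) := by
    refine ⟨lt_of_le_of_ne hα.1 fun h => hθ ?_, lt_of_le_of_ne hα.2 fun h => hθ ?_⟩
    · simp [← h]
    · simp [h]
  have hcos := Real.cos_pos_of_mem_Ioo hα'
  have hw : G (wrap (betam z θ) + π + alpham z θ, alpham z θ) = G (θ, alpham z θ) := by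
    have hp : Function.Periodic (fun x => G (x, alpham z θ)) (2 * π) := fun x => hper x _
    have := hp.sub_int_mul_eq (n := toIocDiv Real.two_pi_pos 0 (betam z θ)) (x := θ)
    rw [← this, wrap, toIocMod, betam, zsmul_eq_mul]
    congr 2
    ring
  rw [hg _ _ hα', hw, muC, ← mul_assoc, ← Complex.ofReal_mul, ← Real.rpow_add hcos]
  simp

theorem HasDerivAt.tline_eq {g Q : ℝ × ℝ → ℂ}
    (hg : ∀ b, ∀ a ∈ Set.Ioo (-(π / 2)) (π / 2), g (b, a) = Q (b + π + a, a)) {b a : ℝ}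
    (ha : a ∈ Set.Ioo (-(π / 2)) (π / 2)) {d : ℂ}
    (hd : HasDerivAt (fun t => Q (b + π + a, t)) d a)
    (hQ : DifferentiableAt ℝ Q (b + π + a, a)) : Tline g (b, a) = -d := by
  have h1 : HasDerivAt (fun t => g (t, a)) (fderiv ℝ Q (b + π + a, a) (1, 0)) b := by
    simp only [hg _ a ha]
    exact hQ.hasFDerivAt.comp_hasDerivAt b
      ((((hasDerivAt_id b).add_const π).add_const a).prodMk (hasDerivAt_const b a))
  have h2 : HasDerivAt (fun t => g (b, t)) (fderiv ℝ Q (b + π + a, a) (1, 1)) a := by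
    have hline : HasDerivAt (fun t => (b + π + t, t)) ((1, 1) : ℝ × ℝ) a :=
      ((hasDerivAt_id a).const_add (b + π)).prodMk (hasDerivAt_id a)
    refine HasDerivAt.congr_of_eventuallyEq
      (HasFDerivAt.comp_hasDerivAt (f := fun t => (b + π + t, t)) a hQ.hasFDerivAt hline) ?_
    filter_upwards [isOpen_Ioo.mem_nhds ha] with t ht using hg b t ht
  have h3 : d = fderiv ℝ Q (b + π + a, a) (0, 1) := hd.unique
    (hQ.hasFDerivAt.comp_hasDerivAt a ((hasDerivAt_const a (b + π + a)).prodMk (hasDerivAt_id a)))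
  have h4 : ((1, 1) : ℝ × ℝ) = (1, 0) + (0, 1) := by simp
  rw [Tline, dBeta, dAlpha, h1.deriv, h2.deriv, h3, h4, map_add]
  ring

/-- The operator `𝓣_γ`, conjugated by `μ^{2γ+1}`, in the coordinates `(θ, sin α)`. -/
def gegenbauerOp (γ : ℝ) (G : ℝ × ℝ → ℂ) (p : ℝ × ℝ) : ℂ :=
  -(Real.cos p.2 : ℂ) ^ 2 * sinDeriv (sinDeriv G) p +
    (2 * γ + 3) * (Real.sin p.2 : ℂ) * sinDeriv G p + (γ + 1) ^ 2 * G p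

theorem IsSinEven.hasDerivAt {G : ℝ × ℝ → ℂ} (hG : IsSinEven G) (x a : ℝ) :
    HasDerivAt (fun t => G (x, t)) (Real.cos a * sinDeriv G (x, a)) a :=
  (hasDerivAt_dAlpha hG.differentiable (x, a)).congr_deriv (hG.dAlpha_eq_cos_mul (x, a))

theorem IsSinEven.tgam_eq {G : ℝ × ℝ → ℂ} (hG : IsSinEven G) {h : ℝ × ℝ → ℂ} (γ : ℝ)
    (hh : ∀ b, ∀ a ∈ Set.Icc (-(π / 2)) (π / 2), h (b, a) = G (b + π + a, a)) (b : ℝ) {a : ℝ}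
    (ha : a ∈ Set.Ioo (-(π / 2)) (π / 2)) :
    Tgam γ (fun p => muC (2 * γ + 1) p * h p) (b, a) =
      muC (2 * γ + 1) (b, a) * gegenbauerOp γ G (b + π + a, a) := by
  have hsin : ∀ t : ℝ, HasDerivAt (fun t : ℝ => (Real.sin t : ℂ)) (Real.cos t : ℂ) t :=
    fun t => (Real.hasDerivAt_sin t).ofReal_comp
  have hcos : ∀ t : ℝ, HasDerivAt (fun t : ℝ => (Real.cos t : ℂ)) (-(Real.sin t : ℂ)) t :=
    fun t => by simpa using (Real.hasDerivAt_cos t).ofReal_comp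
  have step : ∀ b, ∀ a ∈ Set.Ioo (-(π / 2)) (π / 2),
      muC (-(2 * γ)) (b, a) * Tline (fun p => muC (2 * γ + 1) p * h p) (b, a) =
        -((Real.cos a : ℂ) ^ 2 * sinDeriv G (b + π + a, a) -
          (2 * γ + 1) * ((Real.sin a : ℂ) * G (b + π + a, a))) := by
    intro b a ha
    have hc := Real.cos_pos_of_mem_Ioo ha
    have hpow : HasDerivAt (fun t : ℝ => ((Real.cos t ^ (2 * γ + 1) : ℝ) : ℂ))
        ((-Real.sin a * (2 * γ + 1) * Real.cos a ^ (2 * γ + 1 - 1) : ℝ) : ℂ) a :=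
      ((Real.hasDerivAt_cos a).rpow_const (Or.inl hc.ne')).ofReal_comp
    have hd : DifferentiableAt ℝ (fun p : ℝ × ℝ => muC (2 * γ + 1) p * G p) (b + π + a, a) :=
      (hpow.differentiableAt.comp (f := Prod.snd) (b + π + a, a) differentiableAt_snd).mul
        (hG.differentiable _)
    rw [HasDerivAt.tline_eq (Q := fun p => muC (2 * γ + 1) p * G p)
      (fun b a ha => by simp only [hh b a (Ioo_subset_Icc_self ha), muC]) ha
      (hpow.fun_mul (hG.hasDerivAt (b + π + a) a)) hd]
    simp only [muC, Real.rpow_neg hc.le, add_sub_cancel_right, Real.rpow_add hc, Real.rpow_one]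
    have hne : ((Real.cos a ^ (2 * γ) : ℝ) : ℂ) ≠ 0 := by
      exact_mod_cast (Real.rpow_pos_of_pos hc _).ne'
    push_cast [-Complex.ofReal_cos, -Complex.ofReal_sin]
    field_simp
    ring
  have hd : DifferentiableAt ℝ (fun p : ℝ × ℝ => -((Real.cos p.2 : ℂ) ^ 2 * sinDeriv G p -
      (2 * γ + 1) * ((Real.sin p.2 : ℂ) * G p))) (b + π + a, a) := by
    have h1 := (hcos a).differentiableAt.comp (f := Prod.snd) (b + π + a, a) differentiableAt_snd
    have h2 := (hsin a).differentiableAt.comp (f := Prod.snd) (b + π + a, a) differentiableAt_snd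
    exact (((h1.pow 2).mul (hG.isSinEven_sinDeriv.differentiable _)).sub
      ((h2.mul (hG.differentiable _)).const_mul _)).neg
  have hder := ((((hcos a).fun_pow 2).fun_mul (hG.isSinEven_sinDeriv.hasDerivAt (b + π + a) a)).fun_sub
    (((hsin a).fun_mul (hG.hasDerivAt (b + π + a) a)).const_mul (2 * (γ : ℂ) + 1))).fun_neg
  have hc := Real.cos_pos_of_mem_Ioo ha
  rw [Tgam, HasDerivAt.tline_eq step ha hder hd, hh b a (Ioo_subset_Icc_self ha), gegenbauerOp]
  simp only [muC, Real.rpow_add hc, Real.rpow_one]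
  push_cast [-Complex.ofReal_cos, -Complex.ofReal_sin]
  ring

/-! ## Polar derivatives of the backprojection -/
theorem HasFDerivAt.dOmega_eq {f : ℂ → ℂ} {L : ℂ →L[ℝ] ℂ} {z : ℂ} (h : HasFDerivAt f L z) :
    dOmega f z = L (Complex.I * z) := by
  have hz : (‖z‖ : ℂ) * Complex.exp ((z.arg : ℂ) * Complex.I) = z := Complex.norm_mul_exp_arg_mul_I z
  have hc : HasDerivAt (fun w : ℝ => (‖z‖ : ℂ) * Complex.exp ((w : ℂ) * Complex.I))
      (Complex.I * z) z.arg := by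
    have h1 := (((Complex.ofRealCLM.hasDerivAt (x := z.arg)).mul_const
      Complex.I).cexp.const_mul (‖z‖ : ℂ))
    refine h1.congr_deriv ?_
    simp only [Complex.ofRealCLM_apply]
    rw [← mul_assoc, hz]
    simp [mul_comm]
  rw [← hz] at h
  exact (h.comp_hasDerivAt z.arg hc).deriv

theorem HasFDerivAt.dRho_eq {f : ℂ → ℂ} {L : ℂ →L[ℝ] ℂ} {z : ℂ} (h : HasFDerivAt f L z) :
    dRho f z = L (Complex.exp ((z.arg : ℂ) * Complex.I)) := by
  have hz : (‖z‖ : ℂ) * Complex.exp ((z.arg : ℂ) * Complex.I) = z := Complex.norm_mul_exp_arg_mul_I z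
  have hc : HasDerivAt (fun r : ℝ => (r : ℂ) * Complex.exp ((z.arg : ℂ) * Complex.I))
      (Complex.exp ((z.arg : ℂ) * Complex.I)) ‖z‖ := by
    simpa using (Complex.ofRealCLM.hasDerivAt (x := ‖z‖)).mul_const
      (Complex.exp ((z.arg : ℂ) * Complex.I))
  rw [← hz] at h
  exact (h.comp_hasDerivAt ‖z‖ hc).deriv

theorem dOmega_congr {f g : ℂ → ℂ} {R : ℝ} (h : EqOn f g (Metric.ball 0 R)) {z : ℂ}
    (hz : z ∈ Metric.ball (0 : ℂ) R) : dOmega f z = dOmega g z := by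
  have : ∀ w : ℝ, f ((‖z‖ : ℂ) * Complex.exp ((w : ℂ) * Complex.I)) =
      g ((‖z‖ : ℂ) * Complex.exp ((w : ℂ) * Complex.I)) := fun w => h (by simpa using hz)
  simp only [dOmega, this]

theorem IsSinEven.bpInt_dBeta {G : ℝ × ℝ → ℂ} (hG : IsSinEven G)
    (hper : ∀ x a, G (x + 2 * π, a) = G (x, a)) {z : ℂ} (hz : z ∈ Metric.ball (0 : ℂ) 1) :
    bpInt (dBeta G) z = bpDeriv G z (Complex.I * z) := by
  have hβ := (contDiff_dBeta hG.contDiff).continuous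
  have hca := (hG.isSinEven_sinDeriv.mul_left contDiff_ofReal_sin).contDiff.continuous
  have hcb := (hG.isSinEven_sinDeriv.mul_left contDiff_ofReal_cos).contDiff.continuous
  have hd : ∀ θ : ℝ, HasDerivAt (fun θ => G (θ, alpham z θ))
      (dBeta G (θ, alpham z θ) + ((z.im : ℂ) * (-(Real.sin θ : ℂ) *
        sinDeriv G (θ, alpham z θ)) -
        (z.re : ℂ) * ((Real.cos θ : ℂ) * sinDeriv G (θ, alpham z θ)))) θ := by
    intro θ
    obtain ⟨h₁, h₂⟩ := abs_sin_coord_lt_one hz θ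
    have hs : HasDerivAt (fun θ => z.im * Real.cos θ - z.re * Real.sin θ)
        (z.im * (-Real.sin θ) - z.re * Real.cos θ) θ :=
      ((Real.hasDerivAt_cos θ).const_mul _).sub ((Real.hasDerivAt_sin θ).const_mul _)
    have hα := (Real.hasDerivAt_arcsin h₁.ne' h₂.ne).comp θ hs
    rw [show Real.arcsin ∘ (fun θ => z.im * Real.cos θ - z.re * Real.sin θ) = alpham z from
      (funext (alpham_eq z)).symm] at hα
    refine ((hG.differentiable (θ, alpham z θ)).hasFDerivAt.comp_hasDerivAt θ
      ((hasDerivAt_id θ).prodMk hα)).congr_deriv ?_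
    generalize hδ : 1 / √(1 - (z.im * Real.cos θ - z.re * Real.sin θ) ^ 2) *
      (z.im * (-Real.sin θ) - z.re * Real.cos θ) = δ
    have hdec : ((1, δ) : ℝ × ℝ) = (1, 0) + δ • (0, 1) := by simp
    have hcosδ : Real.cos (alpham z θ) * δ = z.im * (-Real.sin θ) - z.re * Real.cos θ := by
      have hpos := cos_alpham_pos hz θ
      rw [alpham_eq, Real.cos_arcsin] at hpos ⊢
      rw [← hδ]
      field_simp
    rw [hdec, map_add, map_smul, ← dBeta_eq_fderiv hG.differentiable,
      ← dAlpha_eq_fderiv hG.differentiable, hG.dAlpha_eq_cos_mul, Complex.real_smul]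
    have := congrArg (fun r : ℝ => (r : ℂ)) hcosδ
    push_cast [-Complex.ofReal_cos, -Complex.ofReal_sin] at this
    linear_combination sinDeriv G (θ, alpham z θ) * this
  have hi := intervalIntegrable_comp_alpham hβ z 0 (2 * π)
  have hia := (intervalIntegrable_comp_alpham hca z 0 (2 * π)).const_mul (z.im : ℂ)
  have hib := (intervalIntegrable_comp_alpham hcb z 0 (2 * π)).const_mul (z.re : ℂ)
  have h0 := intervalIntegral.integral_eq_sub_of_hasDerivAt (fun θ _ => hd θ)
    (hi.add (hia.sub hib))
  have h2π : G (2 * π, alpham z (2 * π)) = G (0, alpham z 0) := by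
    have := hper 0 (alpham z 0)
    rw [zero_add] at this
    simpa [alpham_eq] using this
  rw [h2π, sub_self, intervalIntegral.integral_add hi (hia.sub hib),
    intervalIntegral.integral_sub hia hib, intervalIntegral.integral_const_mul,
    intervalIntegral.integral_const_mul] at h0
  simp only [bpDeriv, bpInt, _root_.add_apply, _root_.smul_apply,
    ContinuousLinearMap.comp_apply, Complex.reCLM_apply, Complex.imCLM_apply,
    Complex.ofRealCLM_apply, Complex.I_mul_re, Complex.I_mul_im, smul_eq_mul]
  push_cast [-Complex.ofReal_cos, -Complex.ofReal_sin]
  linear_combination h0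

theorem sinDeriv_mul_left (m : ℝ → ℂ) (G : ℝ × ℝ → ℂ) :
    sinDeriv (fun p => m p.1 * G p) = fun p => m p.1 * sinDeriv G p := by
  have h : ∀ H : ℝ × ℝ → ℂ, dAlpha (fun p => m p.1 * H p) = fun p => m p.1 * dAlpha H p :=
    fun H => funext fun p => by simp only [dAlpha, deriv_const_mul_field]
  funext p
  simp only [sinDeriv, h]
  split_ifs <;> ring

theorem bpDeriv_apply (G : ℝ × ℝ → ℂ) (z v : ℂ) :
    bpDeriv G z v = bpInt (fun p => -(Real.sin p.1 : ℂ) * sinDeriv G p) z * v.re +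
      bpInt (fun p => (Real.cos p.1 : ℂ) * sinDeriv G p) z * v.im := rfl

theorem dRho_dRho_eq {f : ℂ → ℂ} {A B : ℂ → ℂ} {A' B' : ℂ →L[ℝ] ℂ} {R : ℝ}
    (hf : ∀ z ∈ Metric.ball (0 : ℂ) R, dRho f z = A z * (Real.cos z.arg : ℂ) +
      B z * (Real.sin z.arg : ℂ))
    {z : ℂ} (hz : z ∈ Metric.ball (0 : ℂ) R) (hz0 : z ≠ 0) (hA : HasFDerivAt A A' z)
    (hB : HasFDerivAt B B' z) :
    dRho (dRho f) z = A' (Complex.exp ((z.arg : ℂ) * Complex.I)) * (Real.cos z.arg : ℂ) +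
      B' (Complex.exp ((z.arg : ℂ) * Complex.I)) * (Real.sin z.arg : ℂ) := by
  have h := ((hA.mul_const (Real.cos z.arg : ℂ)).fun_add
    (hB.mul_const (Real.sin z.arg : ℂ))).dRho_eq
  simp only [_root_.add_apply, _root_.smul_apply, smul_eq_mul] at h
  have key : dRho (dRho f) z =
      dRho (fun w => A w * (Real.cos z.arg : ℂ) + B w * (Real.sin z.arg : ℂ)) z := by
    refine Filter.EventuallyEq.deriv_eq ?_
    have hmem : ‖z‖ ∈ Set.Ioo 0 R := ⟨norm_pos_iff.2 hz0, mem_ball_zero_iff.1 hz⟩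
    filter_upwards [isOpen_Ioo.mem_nhds hmem] with r hr
    have harg : ((r : ℂ) * Complex.exp ((z.arg : ℂ) * Complex.I)).arg = z.arg := by
      rw [Complex.arg_real_mul _ hr.1, Complex.arg_exp_mul_I, toIocMod_eq_self]
      have := Complex.arg_mem_Ioc z
      rwa [show -π + 2 * π = π by ring]
    have hball : (r : ℂ) * Complex.exp ((z.arg : ℂ) * Complex.I) ∈ Metric.ball (0 : ℂ) R := by
      simpa [abs_of_pos hr.1] using hr.2
    rw [hf _ hball, harg]
  rw [key, h]
  ring

theorem IsSinEven.bpInt_gegenbauerOp {G : ℝ × ℝ → ℂ} (hG : IsSinEven G) (γ : ℝ) {z : ℂ}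
    (hz : z ∈ Metric.ball (0 : ℂ) 1) :
    bpInt (gegenbauerOp γ G) z =
      (z.re ^ 2 - 1) * bpInt (fun p => -(Real.sin p.1 : ℂ) *
          (-(Real.sin p.1 : ℂ) * sinDeriv (sinDeriv G) p)) z +
        2 * z.re * z.im * bpInt (fun p => -(Real.sin p.1 : ℂ) *
          ((Real.cos p.1 : ℂ) * sinDeriv (sinDeriv G) p)) z +
        (z.im ^ 2 - 1) * bpInt (fun p => (Real.cos p.1 : ℂ) *
          ((Real.cos p.1 : ℂ) * sinDeriv (sinDeriv G) p)) z +
        (2 * γ + 3) * z.re * bpInt (fun p => -(Real.sin p.1 : ℂ) * sinDeriv G p) z +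
        (2 * γ + 3) * z.im * bpInt (fun p => (Real.cos p.1 : ℂ) * sinDeriv G p) z +
        (γ + 1) ^ 2 * bpInt G z := by
  have hs := contDiff_ofReal_sin
  have hc := contDiff_ofReal_cos
  have h1 := hG.isSinEven_sinDeriv
  have h2 := h1.isSinEven_sinDeriv
  have int : ∀ {Q : ℝ × ℝ → ℂ}, IsSinEven Q → ∀ k : ℂ,
      IntervalIntegrable (fun θ => k * Q (θ, alpham z θ)) volume 0 (2 * π) := fun hQ k =>
    (intervalIntegrable_comp_alpham hQ.contDiff.continuous z 0 (2 * π)).const_mul k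
  have i1 := int ((h2.mul_left hs).mul_left hs) ((z.re : ℂ) ^ 2 - 1)
  have i2 := int ((h2.mul_left hc).mul_left hs) (2 * (z.re : ℂ) * z.im)
  have i3 := int ((h2.mul_left hc).mul_left hc) ((z.im : ℂ) ^ 2 - 1)
  have i4 := int (h1.mul_left hs) ((2 * γ + 3) * (z.re : ℂ))
  have i5 := int (h1.mul_left hc) ((2 * γ + 3) * (z.im : ℂ))
  have i6 := int hG (((γ : ℂ) + 1) ^ 2)
  simp only [bpInt, ← intervalIntegral.integral_const_mul]
  rw [← intervalIntegral.integral_add i1 i2, ← intervalIntegral.integral_add (i1.add i2) i3,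
    ← intervalIntegral.integral_add ((i1.add i2).add i3) i4,
    ← intervalIntegral.integral_add (((i1.add i2).add i3).add i4) i5,
    ← intervalIntegral.integral_add ((((i1.add i2).add i3).add i4).add i5) i6]
  refine intervalIntegral.integral_congr fun θ _ => ?_
  have e1 : (Real.sin (alpham z θ) : ℂ) =
      z.im * (Real.cos θ : ℂ) - z.re * (Real.sin θ : ℂ) := by
    rw [sin_alpham (Metric.ball_subset_closedBall hz)]
    push_cast
    ring
  have e2 : (Real.cos (alpham z θ) : ℂ) ^ 2 =
      1 - (z.im * (Real.cos θ : ℂ) - z.re * (Real.sin θ : ℂ)) ^ 2 := by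
    have := congrArg (fun r : ℝ => (r : ℂ)) (Real.sin_sq_add_cos_sq (alpham z θ))
    push_cast [-Complex.ofReal_cos, -Complex.ofReal_sin] at this
    rw [← e1]
    linear_combination this
  have e3 : (Real.sin θ : ℂ) ^ 2 + (Real.cos θ : ℂ) ^ 2 = 1 := by
    exact_mod_cast Real.sin_sq_add_cos_sq θ
  simp only [gegenbauerOp, e1, e2]
  linear_combination sinDeriv (sinDeriv G) (θ, alpham z θ) * e3

theorem IsSinEven.lop_bpInt {G : ℝ × ℝ → ℂ} (hG : IsSinEven G) (γ : ℝ) {f : ℂ → ℂ}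
    (hf : EqOn f (bpInt G) (Metric.ball 0 1)) {z : ℂ} (hz : z ∈ Metric.ball (0 : ℂ) 1)
    (hz0 : z ≠ 0) : Lop γ f z = bpInt (gegenbauerOp γ G) z := by
  have hder : ∀ w ∈ Metric.ball (0 : ℂ) 1, HasFDerivAt f (bpDeriv G w) w := fun w hw =>
    (hG.hasFDerivAt_bpInt hw).congr_of_eventuallyEq
      (hf.eventuallyEq_of_mem (Metric.isOpen_ball.mem_nhds hw))
  have hA := (hG.isSinEven_sinDeriv.mul_left contDiff_ofReal_sin).hasFDerivAt_bpInt hz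
  have hB := (hG.isSinEven_sinDeriv.mul_left contDiff_ofReal_cos).hasFDerivAt_bpInt hz
  have hrho : ∀ w ∈ Metric.ball (0 : ℂ) 1, dRho f w =
      bpInt (fun p => -(Real.sin p.1 : ℂ) * sinDeriv G p) w * (Real.cos w.arg : ℂ) +
        bpInt (fun p => (Real.cos p.1 : ℂ) * sinDeriv G p) w * (Real.sin w.arg : ℂ) :=
    fun w hw => by
      rw [(hder w hw).dRho_eq, bpDeriv_apply, Complex.exp_ofReal_mul_I_re,
        Complex.exp_ofReal_mul_I_im]
  have homega : EqOn (dOmega f) (fun w =>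
      bpInt (fun p => -(Real.sin p.1 : ℂ) * sinDeriv G p) w * -(w.im : ℂ) +
        bpInt (fun p => (Real.cos p.1 : ℂ) * sinDeriv G p) w * (w.re : ℂ)) (Metric.ball 0 1) :=
    fun w hw => by
      rw [(hder w hw).dOmega_eq, bpDeriv_apply, Complex.I_mul_re, Complex.I_mul_im,
        Complex.ofReal_neg]
  have hre : HasFDerivAt (fun w : ℂ => (w.re : ℂ)) (Complex.ofRealCLM.comp Complex.reCLM) z :=
    (Complex.ofRealCLM.comp Complex.reCLM).hasFDerivAt
  have him : HasFDerivAt (fun w : ℂ => -(w.im : ℂ)) (-Complex.ofRealCLM.comp Complex.imCLM) z :=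
    (Complex.ofRealCLM.comp Complex.imCLM).hasFDerivAt.neg
  have hRR := dRho_dRho_eq hrho hz hz0 hA hB
  have hOO := (dOmega_congr homega hz).trans
    ((hA.fun_mul him).fun_add (hB.fun_mul hre)).dOmega_eq
  have hsin : sinDeriv (fun p => -(Real.sin p.1 : ℂ) * sinDeriv G p) =
      fun p => -(Real.sin p.1 : ℂ) * sinDeriv (sinDeriv G) p :=
    sinDeriv_mul_left (fun θ => -(Real.sin θ : ℂ)) (sinDeriv G)
  have hcos : sinDeriv (fun p => (Real.cos p.1 : ℂ) * sinDeriv G p) =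
      fun p => (Real.cos p.1 : ℂ) * sinDeriv (sinDeriv G) p :=
    sinDeriv_mul_left (fun θ => (Real.cos θ : ℂ)) (sinDeriv G)
  simp only [_root_.add_apply, _root_.smul_apply, _root_.neg_apply, smul_eq_mul, bpDeriv_apply,
    hsin, hcos, Complex.exp_ofReal_mul_I_re, Complex.exp_ofReal_mul_I_im,
    ContinuousLinearMap.comp_apply, Complex.reCLM_apply, Complex.imCLM_apply,
    Complex.ofRealCLM_apply, Complex.I_mul_re, Complex.I_mul_im, Complex.ofReal_neg] at hRR hOO
  have hcomm : bpInt (fun p => (Real.cos p.1 : ℂ) *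
      (-(Real.sin p.1 : ℂ) * sinDeriv (sinDeriv G) p)) z = bpInt (fun p => -(Real.sin p.1 : ℂ) *
      ((Real.cos p.1 : ℂ) * sinDeriv (sinDeriv G) p)) z := by
    congr 1
    funext p
    ring
  have hx : (z.re : ℂ) = ‖z‖ * (Real.cos z.arg : ℂ) := by
    rw [← Complex.ofReal_mul, Complex.norm_mul_cos_arg]
  have hy : (z.im : ℂ) = ‖z‖ * (Real.sin z.arg : ℂ) := by
    rw [← Complex.ofReal_mul, Complex.norm_mul_sin_arg]
  have hρ : (‖z‖ : ℂ) ≠ 0 := by exact_mod_cast norm_ne_zero_iff.2 hz0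
  have hcs : (Real.sin z.arg : ℂ) ^ 2 + (Real.cos z.arg : ℂ) ^ 2 = 1 := by
    exact_mod_cast Real.sin_sq_add_cos_sq z.arg
  rw [hG.bpInt_gegenbauerOp γ hz, Lop, hRR, hOO, hrho z hz, hf hz, hcomm, hx, hy]
  generalize bpInt (fun p => -(Real.sin p.1 : ℂ) *
    (-(Real.sin p.1 : ℂ) * sinDeriv (sinDeriv G) p)) z = P
  generalize bpInt (fun p => -(Real.sin p.1 : ℂ) *
    ((Real.cos p.1 : ℂ) * sinDeriv (sinDeriv G) p)) z = Q
  generalize bpInt (fun p => (Real.cos p.1 : ℂ) *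
    ((Real.cos p.1 : ℂ) * sinDeriv (sinDeriv G) p)) z = R
  generalize (Real.sin z.arg : ℂ) = s at *
  generalize (Real.cos z.arg : ℂ) = c at *
  field_simp
  linear_combination -(‖z‖ : ℂ) * (P + R) * hcs

/-- (1) The backprojection `I₀^♯ μ^{-2γ-1}` maps `μ^{2γ+1} C^∞_{α,+,+}(∂₊S𝔻)`
into `C^∞(𝔻)`. (2) The intertwining relations
`I₀^♯ μ^{-2γ-1} 𝓣_γ = 𝓛_γ I₀^♯ μ^{-2γ-1}` and `I₀^♯ μ^{-2γ-1} ∂_β = ∂_ω I₀^♯ μ^{-2γ-1}` hold on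
`μ^{2γ+1} C^∞_{α,+,+}(∂₊S𝔻)` (the first identity is stated away from the polar-coordinate
center `z = 0`). -/
theorem backprojection_intertwining (γ : ℝ) (hγ : -1 < γ) :
    (∀ h : ℝ × ℝ → ℂ, MemCapp h →
      CinfDisk (BPW γ (fun p => muC (2 * γ + 1) p * h p))) ∧
    (∀ h : ℝ × ℝ → ℂ, MemCapp h →
      (∀ z ∈ Metric.ball (0 : ℂ) 1 \ {0},
        BPW γ (Tgam γ (fun p => muC (2 * γ + 1) p * h p)) z
          = Lop γ (BPW γ (fun p => muC (2 * γ + 1) p * h p)) z) ∧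
      (∀ z ∈ Metric.ball (0 : ℂ) 1,
        BPW γ (dBeta (fun p => muC (2 * γ + 1) p * h p)) z
          = dOmega (BPW γ (fun p => muC (2 * γ + 1) p * h p)) z)) := by
  refine ⟨fun h hh => ?_, fun h hh => ?_⟩
  · obtain ⟨G, hG, hper, hhG⟩ := hh.exists_isSinEven
    exact hG.contDiffOn_bpInt.congr fun z hz => BPW_eq_bpInt hper
      (fun b a ha => by rw [hhG b a (Ioo_subset_Icc_self ha)]) hz
  · obtain ⟨G, hG, hper, hhG⟩ := hh.exists_isSinEven
    have hf : EqOn (BPW γ fun p => muC (2 * γ + 1) p * h p) (bpInt G) (Metric.ball 0 1) :=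
      fun z hz => BPW_eq_bpInt hper (fun b a ha => by rw [hhG b a (Ioo_subset_Icc_self ha)])
        (Metric.ball_subset_closedBall hz)
    refine ⟨fun z hz => ?_, fun z hz => ?_⟩
    · rw [hG.lop_bpInt γ hf hz.1 hz.2]
      refine BPW_eq_bpInt (fun x a => ?_) (fun b a ha => hG.tgam_eq γ hhG b ha)
        (Metric.ball_subset_closedBall hz.1)
      simp only [gegenbauerOp, sinDeriv, dAlpha, hper]
    · rw [dOmega_congr hf hz, (hG.hasFDerivAt_bpInt hz).dOmega_eq, ← hG.bpInt_dBeta hper hz]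
      refine BPW_eq_bpInt (fun x a => ?_) (fun b a ha => ?_) (Metric.ball_subset_closedBall hz)
      · have := deriv_comp_add_const (fun x => G (x, a)) (2 * π) x
        simp only [hper] at this
        exact this.symm
      · have := deriv_comp_add_const (fun x => G (x, a)) (π + a) b
        simp only [← add_assoc] at this
        simp only [dBeta, hhG _ a (Ioo_subset_Icc_self ha), muC, deriv_const_mul_field, this]

end
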